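/- Let F be a field and let a, b ∈ F[x] with b monic of degree d₁ and deg a ≤ d₀ + d₁, and write a = q·b + r with deg r < d₁ (so deg q ≤ d₀). Then rev_{d₁}(b) has constant term 1, hence is a unit modulo x^{d₀+1}; moreover, if u ∈ F[x] satisfies deg u ≤ d₀ and u·rev_{d₁}(b) ≡ rev_{d₀+d₁}(a) (mod x^{d₀+1}), then u = rev_{d₀}(q). In other words, rev_{d₀}(q) = rev_{d₀+d₁}(a)·rev_{d₁}(b)^{−1} mod x^{d₀+1}, and q = rev_{d₀}(rev_{d₀}(q)). -/

import Mathlib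

open Polynomial

theorem isCoprime_X_of_coeff_zero_eq_one {R : Type*} [CommRing R] {p : R[X]}
    (hp : p.coeff 0 = 1) : IsCoprime X p := by
  refine ⟨-p.divX, 1, ?_⟩
  have h := p.divX_mul_X_add
  rw [hp, C_1] at h
  linear_combination -h

theorem natDegree_le_of_natDegree_mul_monic_le {R : Type*} [Semiring R] {q b : R[X]}
    (hb : b.Monic) {n : ℕ} (h : (q * b).natDegree ≤ n + b.natDegree) : q.natDegree ≤ n := by
  rcases eq_or_ne q 0 with rfl | hq
  · simp
  · rw [natDegree_mul' (by simpa [hb.leadingCoeff] using hq)] at h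
    omega

theorem X_pow_dvd_reflect_of_degree_lt {R : Type*} [Semiring R] {r : R[X]} {d n : ℕ}
    (hr : r.degree < (d : WithBot ℕ)) : (X : R[X]) ^ (n + 1) ∣ reflect (n + d) r := by
  rw [X_pow_dvd_iff]
  intro i hi
  rw [coeff_reflect, revAt_le (by omega)]
  apply coeff_eq_zero_of_degree_lt
  exact hr.trans_le (by exact_mod_cast (by omega : d ≤ n + d - i))

theorem eq_of_X_pow_dvd_sub {R : Type*} [Ring R] {p q : R[X]} {n : ℕ}
    (hp : p.natDegree ≤ n) (hq : q.natDegree ≤ n) (h : (X : R[X]) ^ (n + 1) ∣ p - q) :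
    p = q := by
  ext i
  rcases Nat.lt_or_ge n i with hi | hi
  · rw [coeff_eq_zero_of_natDegree_lt (hp.trans_lt hi),
      coeff_eq_zero_of_natDegree_lt (hq.trans_lt hi)]
  · rw [← sub_eq_zero, ← coeff_sub]
    exact X_pow_dvd_iff.1 h i (by omega)

theorem stmt_10 {F : Type*} [Field F] (d₀ d₁ : ℕ) (a b q r : F[X])
    (hb : b.Monic) (hbd : b.natDegree = d₁)
    (ha : a.natDegree ≤ d₀ + d₁)
    (hr : r.degree < (d₁ : WithBot ℕ)) (heq : a = q * b + r) :
    (reflect d₁ b).coeff 0 = 1 ∧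
    (∃ w : F[X], (X : F[X])^(d₀ + 1) ∣ (w * reflect d₁ b - 1)) ∧
    (∀ u : F[X], u.natDegree ≤ d₀ →
      (X : F[X])^(d₀ + 1) ∣ (u * reflect d₁ b - reflect (d₀ + d₁) a) →
      u = reflect d₀ q) ∧
    q = reflect d₀ (reflect d₀ q) := by
  have h0 : (reflect d₁ b).coeff 0 = 1 := by
    rw [coeff_reflect, revAt_zero, ← hbd]
    exact hb.coeff_natDegree
  have hcop : IsCoprime ((X : F[X]) ^ (d₀ + 1)) (reflect d₁ b) :=
    (isCoprime_X_of_coeff_zero_eq_one h0).pow_left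
  refine ⟨h0, ?_, ?_, reflect_reflect.symm⟩
  · obtain ⟨v, w, h⟩ := hcop
    exact ⟨w, -v, by linear_combination h⟩
  · intro u hu hdvd
    have hrd : r.natDegree ≤ d₀ + d₁ :=
      natDegree_le_of_degree_le (hr.le.trans (by exact_mod_cast Nat.le_add_left d₁ d₀))
    have hq : q.natDegree ≤ d₀ := by
      apply natDegree_le_of_natDegree_mul_monic_le hb
      rw [eq_sub_of_add_eq heq.symm, hbd]
      exact natDegree_sub_le_of_le ha hrd |>.trans (max_self _).le
    rw [heq, reflect_add, reflect_mul q b hq hbd.le] at hdvd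
    refine eq_of_X_pow_dvd_sub hu (natDegree_reflect_le.trans (max_le le_rfl hq))
      (hcop.dvd_of_dvd_mul_right ?_)
    convert hdvd.add (X_pow_dvd_reflect_of_degree_lt hr) using 1
    ring
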